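/- Let N be a finite ground set with |N| = n ≥ 3 and let f be the set function with f(∅) = 0 and f(S) = 1 for every nonempty S ⊆ N (so f is subadditive monotone). Then: (i) every subadditive monotone extension of (f, 𝒦₀) equals f, so the SAM ℓ¹-divergence satisfies Δˢᵃᵐ_f(∅) = 0; while (ii) the subadditive ℓ¹-divergence satisfies Δ_f(∅) ≥ 2^n − n − 2. In particular, the gap between the subadditive and SAM divergences can grow exponentially in n. -/

import Mathlib

open Finset

/-- The minimal information family: the empty set, the ground set, and all singletons. -/
def K0 (N : Type*) [Fintype N] : Set (Finset N) :=
  {∅, (Finset.univ : Finset N)} ∪ {S : Finset N | ∃ i : N, S = {i}}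

/-- A set function is subadditive if `f (S ∪ T) ≤ f S + f T` for disjoint `S`, `T`. -/
def SubadditiveSF {N : Type*} [DecidableEq N] (f : Finset N → ℝ) : Prop :=
  ∀ S T : Finset N, Disjoint S T → f (S ∪ T) ≤ f S + f T

/-- A set function is monotone if `S ⊆ T` implies `f S ≤ f T`. -/
def MonotoneSF {N : Type*} (f : Finset N → ℝ) : Prop :=
  ∀ S T : Finset N, S ⊆ T → f S ≤ f T

/-- Elementwise monotonicity: `f S ≤ f (S ∪ {i})`. -/
def MonotoneStep {N : Type*} [DecidableEq N] (f : Finset N → ℝ) : Prop :=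
  ∀ (S : Finset N) (i : N), i ∉ S → f S ≤ f (insert i S)

/-- Upper completion: minimum of `∑ f Sᵢ` over families of pairwise disjoint nonempty
sets `Sᵢ ∈ K` partitioning `S`; it is `0` at `∅`. -/
noncomputable def upperC {N : Type*} [DecidableEq N] (f : Finset N → ℝ)
    (K : Set (Finset N)) (S : Finset N) : ℝ :=
  if S = ∅ then 0 else
    sInf {x : ℝ | ∃ P : Finset (Finset N),
      (∀ T ∈ P, T ∈ K) ∧ (∀ T ∈ P, T ≠ ∅) ∧
      (∀ T₁ ∈ P, ∀ T₂ ∈ P, T₁ ≠ T₂ → Disjoint T₁ T₂) ∧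
      P.sup id = S ∧ x = ∑ T ∈ P, f T}

/-- Lower completion: maximum of `f T - upperC f K (T \ S)` over `T ∈ K` with `S ⊆ T`. -/
noncomputable def lowerC {N : Type*} [DecidableEq N] (f : Finset N → ℝ)
    (K : Set (Finset N)) (S : Finset N) : ℝ :=
  sSup {x : ℝ | ∃ T ∈ K, S ⊆ T ∧ x = f T - upperC f K (T \ S)}

/-- The ℓ¹-divergence of `f` with revealed family `K ⊆ 2^N \ K0`. -/
noncomputable def ldiv {N : Type*} [Fintype N] [DecidableEq N] (f : Finset N → ℝ)
    (K : Set (Finset N)) : ℝ :=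
  ∑ T : Finset N, (upperC f (K0 N ∪ K) T - lowerC f (K0 N ∪ K) T)

/-- SAM upper completion: minimum of `∑ f Sᵢ` over nonempty finite families
`S₁, …, S_k ∈ K` covering `S`. -/
noncomputable def samUpper {N : Type*} [DecidableEq N] (f : Finset N → ℝ)
    (K : Set (Finset N)) (S : Finset N) : ℝ :=
  sInf {x : ℝ | ∃ (k : ℕ) (Ss : Fin (k + 1) → Finset N),
    (∀ i, Ss i ∈ K) ∧ S ⊆ Finset.univ.sup Ss ∧ x = ∑ i, f (Ss i)}

/-- SAM lower completion. -/
noncomputable def samLower {N : Type*} [DecidableEq N] (f : Finset N → ℝ)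
    (K : Set (Finset N)) (S : Finset N) : ℝ :=
  max (sSup {x : ℝ | ∃ Y ∈ K, Y ⊆ S ∧ x = f Y})
      (sSup {x : ℝ | ∃ X ∈ K, S ⊆ X ∧ x = f X - samUpper f K (X \ S)})

/-- The SAM ℓ¹-divergence. -/
noncomputable def samDiv {N : Type*} [Fintype N] [DecidableEq N] (f : Finset N → ℝ)
    (K : Set (Finset N)) : ℝ :=
  ∑ T : Finset N, (samUpper f (K0 N ∪ K) T - samLower f (K0 N ∪ K) T)

/-- `{(α i, T i)}` is a fractional cover of `S`. -/
def IsFracCover {N : Type*} [DecidableEq N] (S : Finset N) (k : ℕ)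
    (α : Fin k → ℝ) (T : Fin k → Finset N) : Prop :=
  (∀ i, 0 < α i) ∧
  ∀ j ∈ S, (1 : ℝ) ≤ ∑ i ∈ Finset.univ.filter (fun i => j ∈ T i), α i

/-- A set function is fractionally subadditive. -/
def FracSubadditive {N : Type*} [DecidableEq N] (f : Finset N → ℝ) : Prop :=
  ∀ (S : Finset N) (k : ℕ) (α : Fin k → ℝ) (T : Fin k → Finset N),
    IsFracCover S k α T → f S ≤ ∑ i, α i * f (T i)

/-- XOS: pointwise maximum of finitely many nonnegative additive set functions. -/
def IsXOS {N : Type*} (f : Finset N → ℝ) : Prop :=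
  ∃ (s : ℕ) (a : Fin (s + 1) → N → ℝ),
    (∀ i j, 0 ≤ a i j) ∧
    ∀ S : Finset N, f S = Finset.univ.sup' Finset.univ_nonempty (fun i => ∑ j ∈ S, a i j)

/-- XOS upper completion: infimum of `∑ αᵢ f Tᵢ` over fractional covers of `S`
using sets from `K`. -/
noncomputable def xosUpper {N : Type*} [DecidableEq N] (f : Finset N → ℝ)
    (K : Set (Finset N)) (S : Finset N) : ℝ :=
  sInf {x : ℝ | ∃ (k : ℕ) (α : Fin k → ℝ) (T : Fin k → Finset N),
    IsFracCover S k α T ∧ (∀ i, T i ∈ K) ∧ x = ∑ i, α i * f (T i)}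

theorem MonotoneStep.monotoneSF {N : Type*} [DecidableEq N] {f : Finset N → ℝ}
    (h : MonotoneStep f) : MonotoneSF f := by
  intro S T hST
  have key : ∀ U : Finset N, f S ≤ f (S ∪ U) := by
    intro U
    induction U using Finset.induction_on with
    | empty => simp
    | insert i U _ ih =>
      rw [Finset.union_insert]
      by_cases hi : i ∈ S ∪ U
      · rwa [Finset.insert_eq_of_mem hi]
      · exact ih.trans (h _ i hi)
  simpa [Finset.union_eq_right.mpr hST] using key T

section Membership

variable {N : Type*} [Fintype N]

theorem empty_mem_K0 : (∅ : Finset N) ∈ K0 N := by simp [K0]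

theorem univ_mem_K0 : (Finset.univ : Finset N) ∈ K0 N := by simp [K0]

theorem singleton_mem_K0 (i : N) : ({i} : Finset N) ∈ K0 N := by simp [K0]

end Membership

section Indicator

variable {N : Type*} [DecidableEq N] {f : Finset N → ℝ}

theorem indicator_nonneg (hf : ∀ S : Finset N, f S = if S = ∅ then 0 else 1)
    (S : Finset N) : 0 ≤ f S := by
  rw [hf]; split_ifs <;> norm_num

theorem indicator_le_one (hf : ∀ S : Finset N, f S = if S = ∅ then 0 else 1)
    (S : Finset N) : f S ≤ 1 := by
  rw [hf]; split_ifs <;> norm_num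

theorem indicator_of_nonempty (hf : ∀ S : Finset N, f S = if S = ∅ then 0 else 1)
    {S : Finset N} (hS : S ≠ ∅) : f S = 1 := by
  rw [hf, if_neg hS]

theorem indicator_mono (hf : ∀ S : Finset N, f S = if S = ∅ then 0 else 1)
    {S T : Finset N} (hST : S ⊆ T) : f S ≤ f T := by
  by_cases hT : T = ∅
  · subst hT
    rw [Finset.subset_empty.mp hST]
  · rw [indicator_of_nonempty hf hT]
    exact indicator_le_one hf S

theorem samUpper_indicator [Fintype N] (hf : ∀ S : Finset N, f S = if S = ∅ then 0 else 1)
    (S : Finset N) : samUpper f (K0 N) S = f S := by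
  have hlb : ∀ x ∈ {x : ℝ | ∃ (k : ℕ) (Ss : Fin (k + 1) → Finset N),
      (∀ i, Ss i ∈ K0 N) ∧ S ⊆ Finset.univ.sup Ss ∧ x = ∑ i, f (Ss i)}, f S ≤ x := by
    rintro x ⟨k, Ss, -, hcov, rfl⟩
    by_cases hS : S = ∅
    · rw [hf S, if_pos hS]
      exact Finset.sum_nonneg fun i _ => indicator_nonneg hf _
    · obtain ⟨j, hj⟩ := Finset.nonempty_iff_ne_empty.mpr hS
      obtain ⟨i, -, hi⟩ := Finset.mem_sup.mp (hcov hj)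
      calc f S ≤ 1 := indicator_le_one hf S
        _ = f (Ss i) := (indicator_of_nonempty hf (Finset.ne_empty_of_mem hi)).symm
        _ ≤ ∑ i, f (Ss i) :=
          Finset.single_le_sum (f := fun i => f (Ss i))
            (fun i _ => indicator_nonneg hf _) (Finset.mem_univ i)
  refine IsLeast.csInf_eq ⟨?_, hlb⟩
  by_cases hS : S = ∅
  · exact ⟨0, fun _ => ∅, fun _ => empty_mem_K0, by simp [hS], by simp [hS]⟩
  · refine ⟨0, fun _ => Finset.univ, fun _ => univ_mem_K0, by simp, ?_⟩
    obtain ⟨j, -⟩ := Finset.nonempty_iff_ne_empty.mpr hS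
    simp [indicator_of_nonempty hf hS,
      indicator_of_nonempty hf (Finset.ne_empty_of_mem (Finset.mem_univ j))]

theorem samLower_indicator [Fintype N] (hf : ∀ S : Finset N, f S = if S = ∅ then 0 else 1)
    (S : Finset N) : samLower f (K0 N) S = f S := by
  have hinner : ∀ x ∈ {x : ℝ | ∃ Y ∈ K0 N, Y ⊆ S ∧ x = f Y}, x ≤ f S := by
    rintro x ⟨Y, -, hYS, rfl⟩
    exact indicator_mono hf hYS
  have houter : sSup {x : ℝ | ∃ X ∈ K0 N, S ⊆ X ∧ x = f X - samUpper f (K0 N) (X \ S)} ≤ f S := by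
    refine Real.sSup_le ?_ (indicator_nonneg hf S)
    rintro x ⟨X, -, -, rfl⟩
    rw [samUpper_indicator hf]
    by_cases hS : S = ∅
    · simp [hS, indicator_nonneg hf]
    · rw [indicator_of_nonempty hf hS]
      linarith [indicator_le_one hf X, indicator_nonneg hf (X \ S)]
  have hinner_eq : sSup {x : ℝ | ∃ Y ∈ K0 N, Y ⊆ S ∧ x = f Y} = f S := by
    refine IsGreatest.csSup_eq ⟨?_, hinner⟩
    by_cases hS : S = ∅
    · exact ⟨∅, empty_mem_K0, by simp, by rw [hS]⟩
    · obtain ⟨j, hj⟩ := Finset.nonempty_iff_ne_empty.mpr hS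
      refine ⟨{j}, singleton_mem_K0 j, by simpa using hj, ?_⟩
      rw [indicator_of_nonempty hf hS, indicator_of_nonempty hf (Finset.singleton_ne_empty j)]
  rw [samLower, hinner_eq]
  exact max_eq_left houter

theorem le_upperC [Fintype N] {S : Finset N} (hS : S ≠ ∅) {c : ℝ}
    (h : ∀ P : Finset (Finset N), (∀ T ∈ P, T ∈ K0 N) → (∀ T ∈ P, T ≠ ∅) → P.sup id = S →
      c ≤ ∑ T ∈ P, f T) : c ≤ upperC f (K0 N) S := by
  rw [upperC, if_neg hS]
  refine le_csInf ⟨_, S.image (fun i => {i}), ?_, ?_, ?_, ?_, rfl⟩ ?_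
  · simp [singleton_mem_K0]
  · simp
  · simp +contextual [eq_comm]
  · ext j
    simp
  · rintro x ⟨P, hK, hne, -, hsup, rfl⟩
    exact h P hK hne hsup

theorem sum_indicator_eq_card (hf : ∀ S : Finset N, f S = if S = ∅ then 0 else 1)
    {P : Finset (Finset N)} (hne : ∀ T ∈ P, T ≠ ∅) : ∑ T ∈ P, f T = P.card := by
  rw [Finset.sum_congr rfl fun T hT => indicator_of_nonempty hf (hne T hT)]
  simp

theorem indicator_le_upperC [Fintype N] (hf : ∀ S : Finset N, f S = if S = ∅ then 0 else 1)
    (S : Finset N) : f S ≤ upperC f (K0 N) S := by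
  by_cases hS : S = ∅
  · simp [upperC, hS, hf]
  · refine le_upperC hS fun P _ hne hsup => ?_
    rw [sum_indicator_eq_card hf hne, indicator_of_nonempty hf hS, Nat.one_le_cast,
      Nat.one_le_iff_ne_zero, Finset.card_ne_zero, Finset.nonempty_iff_ne_empty]
    rintro rfl
    exact hS (by simpa using hsup.symm)

theorem two_le_upperC [Fintype N] (hf : ∀ S : Finset N, f S = if S = ∅ then 0 else 1)
    {S : Finset N} (hS : S ∉ K0 N) : 2 ≤ upperC f (K0 N) S := by
  have hS0 : S ≠ ∅ := fun h => hS (h ▸ empty_mem_K0)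
  refine le_upperC hS0 fun P hK hne hsup => ?_
  rw [sum_indicator_eq_card hf hne, Nat.ofNat_le_cast]
  by_contra! hlt
  obtain h | h : P.card = 0 ∨ P.card = 1 := by omega
  · rw [Finset.card_eq_zero] at h
    subst h
    exact hS0 (by simpa using hsup.symm)
  · obtain ⟨T, rfl⟩ := Finset.card_eq_one.mp h
    rw [Finset.sup_singleton, id] at hsup
    exact hS (hsup ▸ hK T (Finset.mem_singleton_self T))

theorem lowerC_le_indicator [Fintype N] (hf : ∀ S : Finset N, f S = if S = ∅ then 0 else 1)
    (S : Finset N) : lowerC f (K0 N) S ≤ f S := by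
  refine Real.sSup_le ?_ (indicator_nonneg hf S)
  rintro x ⟨T, -, -, rfl⟩
  have h := indicator_le_upperC hf (T \ S)
  by_cases hS : S = ∅
  · subst hS
    rw [Finset.sdiff_empty] at h ⊢
    linarith [indicator_nonneg hf ∅]
  · rw [indicator_of_nonempty hf hS]
    linarith [indicator_le_one hf T, indicator_nonneg hf (T \ S)]

end Indicator

/-- for the all-ones function, the SAM divergence at `∅` is zero (every SAM
extension of `(f, K0)` equals `f`), while the subadditive divergence is at least
`2^n − n − 2`, i.e. exponentially large in `n`. -/
theorem sam_vs_subadditive_divergence_gap {N : Type*} [Fintype N] [DecidableEq N]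
    (n : ℕ) (hn : Fintype.card N = n) (h3 : 3 ≤ n)
    (f : Finset N → ℝ) (hf : ∀ S : Finset N, f S = if S = ∅ then 0 else 1) :
    (∀ g : Finset N → ℝ, SubadditiveSF g → MonotoneStep g →
      (∀ S ∈ K0 N, g S = f S) → g = f) ∧
    samDiv f ∅ = 0 ∧
    (2 : ℝ) ^ n - n - 2 ≤ ldiv f ∅ := by
  refine ⟨?_, ?_, ?_⟩
  · intro g _ hstep hg
    funext S
    by_cases hS : S = ∅
    · rw [hS, hg _ empty_mem_K0]
    · obtain ⟨j, hj⟩ := Finset.nonempty_iff_ne_empty.mpr hS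
      have hlo := hstep.monotoneSF {j} S (by simpa using hj)
      have hhi := hstep.monotoneSF S Finset.univ (Finset.subset_univ S)
      rw [hg _ (singleton_mem_K0 j), indicator_of_nonempty hf (Finset.singleton_ne_empty j)] at hlo
      rw [hg _ univ_mem_K0] at hhi
      rw [indicator_of_nonempty hf hS]
      exact le_antisymm (hhi.trans (indicator_le_one hf _)) hlo
  · simp [samDiv, samUpper_indicator hf, samLower_indicator hf]
  · let A : Finset (Finset N) :=
      {∅, Finset.univ} ∪ Finset.univ.image fun i : N => ({i} : Finset N)
    have hA : A.card ≤ n + 2 := by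
      have h1 := Finset.card_union_le ({∅, Finset.univ} : Finset (Finset N))
        (Finset.univ.image fun i : N => ({i} : Finset N))
      have h2 := Finset.card_le_two (a := (∅ : Finset N)) (b := Finset.univ)
      have h3 := Finset.card_image_le (s := (Finset.univ : Finset N))
        (f := fun i : N => ({i} : Finset N))
      rw [Finset.card_univ, hn] at h3
      change (_ ∪ _ : Finset _).card ≤ _
      omega
    have hcompl : (2 : ℝ) ^ n - n - 2 ≤ (Aᶜ.card : ℝ) := by
      have h := Finset.card_add_card_compl A
      rw [Fintype.card_finset, hn] at h
      have h' : (A.card : ℝ) + Aᶜ.card = 2 ^ n := by exact_mod_cast h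
      have hA' : (A.card : ℝ) ≤ n + 2 := by exact_mod_cast hA
      linarith
    rw [ldiv, Set.union_empty]
    calc (2 : ℝ) ^ n - n - 2 ≤ ∑ _T ∈ Aᶜ, (1 : ℝ) := by simpa using hcompl
      _ ≤ ∑ T ∈ Aᶜ, (upperC f (K0 N) T - lowerC f (K0 N) T) := by
        refine Finset.sum_le_sum fun T hT => ?_
        have hTK : T ∉ K0 N := by
          rw [Finset.mem_compl] at hT
          contrapose! hT
          simpa [A, K0, eq_comm, or_assoc] using hT
        linarith [two_le_upperC hf hTK, lowerC_le_indicator hf T, indicator_le_one hf T]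
      _ ≤ ∑ T, (upperC f (K0 N) T - lowerC f (K0 N) T) := by
        refine Finset.sum_le_sum_of_subset_of_nonneg (Finset.subset_univ _) fun T _ _ => ?_
        linarith [indicator_le_upperC hf T, lowerC_le_indicator hf T]
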